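/- arXiv:q-alg/9605036 — 6 statements merged into one kernel-verified Lean document; each statement's English description precedes it below -/
import Mathlib

section
/- The map sending a point (b, c, d) of the unit 2-sphere in ℝ³ to the matrix ![![b*I, c + d*I], ![-c + d*I, -b*I]] is a homeomorphism from the unit 2-sphere onto the set {X ∈ SU(2) : trace X = 0} of trace-free elements of SU(2) (with its subspace topology). -/
open Complex

/-- Elements of `SU(2)` are the matrices `!![z, w; -conj w, conj z]` with `|z|² + |w|² = 1`. -/
theorem mem_specialUnitaryGroup_fin_two_iff {X : Matrix (Fin 2) (Fin 2) ℂ} :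
    X ∈ Matrix.specialUnitaryGroup (Fin 2) ℂ ↔
      X 1 0 = -star (X 0 1) ∧ X 1 1 = star (X 0 0) ∧ normSq (X 0 0) + normSq (X 0 1) = 1 := by
  rw [Matrix.mem_specialUnitaryGroup_iff, Matrix.mem_unitaryGroup_iff']
  constructor
  · rintro ⟨hU, hdet⟩
    have hadj : star X = X.adjugate := by
      calc star X = star X * (X * X.adjugate) := by simp [Matrix.mul_adjugate, hdet]
        _ = X.adjugate := by rw [← mul_assoc, hU, one_mul]
    have h10 : X 1 0 = -star (X 0 1) := by
      have h := congrFun (congrFun hadj 1) 0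
      simp only [Matrix.star_apply, Matrix.adjugate_fin_two, Matrix.of_apply, Matrix.cons_val',
        Matrix.cons_val_zero, Matrix.cons_val_one, Matrix.cons_val_fin_one] at h
      rw [h, neg_neg]
    have h11 : X 1 1 = star (X 0 0) := by
      have h := congrFun (congrFun hadj 0) 0
      simpa [Matrix.adjugate_fin_two] using h.symm
    refine ⟨h10, h11, ?_⟩
    rw [Matrix.det_fin_two, h10, h11, mul_neg, sub_neg_eq_add] at hdet
    simp only [star_def, mul_conj] at hdet
    exact_mod_cast hdet
  · rintro ⟨h10, h11, hn⟩
    have hdet : X.det = 1 := by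
      rw [Matrix.det_fin_two, h10, h11, mul_neg, sub_neg_eq_add]
      simp only [star_def, mul_conj]
      exact_mod_cast hn
    have hadj : star X = X.adjugate := by
      ext i j
      fin_cases i <;> fin_cases j <;> simp [Matrix.adjugate_fin_two, h10, h11]
    exact ⟨by rw [hadj, Matrix.adjugate_mul, hdet, one_smul], hdet⟩

/-- The matrix `!![b i, c + d i; -c + d i, -b i]` attached to `(b, c, d)`. -/
noncomputable def traceFreeMatrix (p : EuclideanSpace ℝ (Fin 3)) : Matrix (Fin 2) (Fin 2) ℂ :=
  !![(p 0 : ℂ) * I, (p 1 : ℂ) + (p 2 : ℂ) * I; -(p 1 : ℂ) + (p 2 : ℂ) * I, -((p 0 : ℂ) * I)]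

theorem continuous_traceFreeMatrix : Continuous traceFreeMatrix := by
  refine continuous_matrix fun i j => ?_
  fin_cases i <;> fin_cases j <;> simp [traceFreeMatrix] <;> fun_prop

theorem trace_traceFreeMatrix (p : EuclideanSpace ℝ (Fin 3)) : (traceFreeMatrix p).trace = 0 := by
  simp [traceFreeMatrix, Matrix.trace_fin_two]

theorem mem_unit_sphere_fin_three_iff {p : EuclideanSpace ℝ (Fin 3)} :
    p ∈ Metric.sphere (0 : EuclideanSpace ℝ (Fin 3)) 1 ↔ p 0 ^ 2 + p 1 ^ 2 + p 2 ^ 2 = 1 := by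
  rw [mem_sphere_zero_iff_norm, EuclideanSpace.norm_eq, Real.sqrt_eq_one]
  simp [Fin.sum_univ_three]

theorem traceFreeMatrix_mem_specialUnitaryGroup_iff {p : EuclideanSpace ℝ (Fin 3)} :
    traceFreeMatrix p ∈ Matrix.specialUnitaryGroup (Fin 2) ℂ ↔
      p ∈ Metric.sphere (0 : EuclideanSpace ℝ (Fin 3)) 1 := by
  rw [mem_specialUnitaryGroup_fin_two_iff, mem_unit_sphere_fin_three_iff]
  simp [traceFreeMatrix, normSq_apply, ← sq, add_assoc]
  exact fun _ => add_comm _ _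

/-- The coordinates `(b, c, d)` read off from the first row of a matrix. -/
noncomputable def firstRowCoords (X : Matrix (Fin 2) (Fin 2) ℂ) : EuclideanSpace ℝ (Fin 3) :=
  !₂[(X 0 0).im, (X 0 1).re, (X 0 1).im]

theorem continuous_firstRowCoords : Continuous firstRowCoords := by
  refine (PiLp.continuous_toLp 2 _).comp (continuous_pi fun i => ?_)
  fin_cases i <;> simp <;> fun_prop

theorem firstRowCoords_traceFreeMatrix (p : EuclideanSpace ℝ (Fin 3)) :
    firstRowCoords (traceFreeMatrix p) = p := by
  ext i
  fin_cases i <;> simp [firstRowCoords, traceFreeMatrix]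

theorem traceFreeMatrix_firstRowCoords {X : Matrix (Fin 2) (Fin 2) ℂ}
    (hX : X ∈ Matrix.specialUnitaryGroup (Fin 2) ℂ) (htr : X.trace = 0) :
    traceFreeMatrix (firstRowCoords X) = X := by
  obtain ⟨h10, h11, -⟩ := mem_specialUnitaryGroup_fin_two_iff.mp hX
  have hre : (X 0 0).re = 0 := by
    rw [Matrix.trace_fin_two, h11] at htr
    have h := congrArg re htr
    simp only [star_def, add_re, conj_re, zero_re] at h
    linarith
  ext i j
  fin_cases i <;> fin_cases j <;>
    simp [traceFreeMatrix, firstRowCoords, h10, h11, Complex.ext_iff, hre]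

/-- The map `(b, c, d) ↦ ![![b i, c + d i], ![-c + d i, -b i]]` is a homeomorphism from the
unit 2-sphere in `ℝ³` onto the set of trace-free elements of `SU(2)`. -/
theorem sphere_homeomorph_traceFree_su2 :
    ∃ f : Metric.sphere (0 : EuclideanSpace ℝ (Fin 3)) 1 ≃ₜ
        {X : Matrix.specialUnitaryGroup (Fin 2) ℂ //
          Matrix.trace (X : Matrix (Fin 2) (Fin 2) ℂ) = 0},
      ∀ p : Metric.sphere (0 : EuclideanSpace ℝ (Fin 3)) 1,
        (((f p : Matrix.specialUnitaryGroup (Fin 2) ℂ)) : Matrix (Fin 2) (Fin 2) ℂ) =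
          !![((p : EuclideanSpace ℝ (Fin 3)) 0 : ℂ) * I,
             ((p : EuclideanSpace ℝ (Fin 3)) 1 : ℂ) + ((p : EuclideanSpace ℝ (Fin 3)) 2 : ℂ) * I;
             -((p : EuclideanSpace ℝ (Fin 3)) 1 : ℂ) + ((p : EuclideanSpace ℝ (Fin 3)) 2 : ℂ) * I,
             -(((p : EuclideanSpace ℝ (Fin 3)) 0 : ℂ) * I)] := by
  exact ⟨{
    toFun := fun p =>
      ⟨⟨traceFreeMatrix p, traceFreeMatrix_mem_specialUnitaryGroup_iff.mpr p.2⟩,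
        trace_traceFreeMatrix p⟩
    invFun := fun X =>
      ⟨firstRowCoords X.1.1, traceFreeMatrix_mem_specialUnitaryGroup_iff.mp <| by
        rw [traceFreeMatrix_firstRowCoords X.1.2 X.2]
        exact X.1.2⟩
    left_inv := fun p => Subtype.ext (firstRowCoords_traceFreeMatrix p)
    right_inv := fun X =>
      Subtype.ext (Subtype.ext (traceFreeMatrix_firstRowCoords X.1.2 X.2))
    continuous_toFun :=
      ((continuous_traceFreeMatrix.comp continuous_subtype_val).subtype_mk _).subtype_mk _
    continuous_invFun :=
      (continuous_firstRowCoords.comp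
        (continuous_subtype_val.comp continuous_subtype_val)).subtype_mk _ },
    fun _ => rfl⟩
end

section
/- Let X, Y ∈ SU(2) be trace-free elements (trace X = trace Y = 0). Then X * Y = Y * X if and only if Y = X or Y = -X. -/
/-- Over a domain of characteristic different from two, commuting trace-free `2 × 2` matrices of
determinant one agree up to sign. -/
theorem Matrix.eq_or_eq_neg_of_commute_of_trace_eq_zero {R : Type*} [CommRing R] [IsDomain R]
    (h2 : (2 : R) ≠ 0) {A B : Matrix (Fin 2) (Fin 2) R} (hA : A.trace = 0) (hB : B.trace = 0)
    (hdA : A.det = 1) (hdB : B.det = 1) (h : Commute A B) : B = A ∨ B = -A := by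
  rw [Matrix.trace_fin_two] at hA hB
  rw [Matrix.det_fin_two, eq_neg_of_add_eq_zero_right hA] at hdA
  rw [Matrix.det_fin_two, eq_neg_of_add_eq_zero_right hB] at hdB
  have h00 := congrFun (congrFun h.eq 0) 0
  have h01 := congrFun (congrFun h.eq 0) 1
  have h10 := congrFun (congrFun h.eq 1) 0
  simp only [Matrix.mul_apply, Fin.sum_univ_two, eq_neg_of_add_eq_zero_right hA,
    eq_neg_of_add_eq_zero_right hB] at h00 h01 h10
  have e01 : A 0 0 * B 0 1 = A 0 1 * B 0 0 :=
    mul_left_cancel₀ h2 (by linear_combination h01)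
  have e10 : A 1 0 * B 0 0 = A 0 0 * B 1 0 :=
    mul_left_cancel₀ h2 (by linear_combination h10)
  -- `B` is the multiple of `A` by minus half the trace of `A * B`.
  obtain ⟨t, ht⟩ : ∃ t : R, t = -(A 0 0 * B 0 0 + A 0 1 * B 1 0) := ⟨_, rfl⟩
  have hBA : B = t • A := by
    ext i j
    fin_cases i <;> fin_cases j <;>
      simp only [Fin.zero_eta, Fin.mk_one, Matrix.smul_apply, smul_eq_mul, ht,
        eq_neg_of_add_eq_zero_right hA, eq_neg_of_add_eq_zero_right hB]
    · linear_combination (-B 0 0) * hdA - A 0 1 * e10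
    · linear_combination (-B 0 1) * hdA - A 0 0 * e01 + A 0 1 * h00
    · linear_combination (-B 1 0) * hdA + A 0 0 * e10
    · linear_combination B 0 0 * hdA + A 0 1 * e10
  have ht2 : t ^ 2 = 1 := by
    simp only [hBA, Matrix.smul_apply, smul_eq_mul] at hdB
    linear_combination hdB - t ^ 2 * hdA
  rcases sq_eq_one_iff.mp ht2 with rfl | rfl
  · exact Or.inl (by simpa using hBA)
  · exact Or.inr (by simpa using hBA)

/-- Two trace-free elements `X`, `Y` of `SU(2)` commute if and only if `Y = X` or `Y = -X`. -/
theorem traceFree_commute_iff (X Y : Matrix.specialUnitaryGroup (Fin 2) ℂ)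
    (hX : Matrix.trace (X : Matrix (Fin 2) (Fin 2) ℂ) = 0)
    (hY : Matrix.trace (Y : Matrix (Fin 2) (Fin 2) ℂ) = 0) :
    X * Y = Y * X ↔
      (Y = X ∨ (Y : Matrix (Fin 2) (Fin 2) ℂ) = -(X : Matrix (Fin 2) (Fin 2) ℂ)) := by
  constructor
  · intro h
    have hc : Commute (X : Matrix (Fin 2) (Fin 2) ℂ) Y := congrArg Subtype.val h
    exact (Matrix.eq_or_eq_neg_of_commute_of_trace_eq_zero two_ne_zero hX hY
      (Matrix.mem_specialUnitaryGroup_iff.mp X.2).2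
      (Matrix.mem_specialUnitaryGroup_iff.mp Y.2).2 hc).imp_left Subtype.ext
  · rintro (rfl | h)
    · rfl
    · exact Subtype.ext (by simp [h])
end

section
/- Let X, Y ∈ SU(2) be trace-free elements with X * Y ≠ Y * X. Then the joint centralizer {g ∈ SU(2) : g * X = X * g and g * Y = Y * g} is exactly {1, -1} (the identity matrix and its negative); i.e. the conjugation action of SU(2) is locally free precisely at irreducible tuples. -/
/-- A `2 × 2` matrix over a domain commuting with two non-commuting matrices is scalar. -/
theorem Matrix.eq_smul_one_of_commute_of_not_commute {R : Type*} [CommRing R] [IsDomain R]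
    {A B M : Matrix (Fin 2) (Fin 2) R} (hA : Commute M A) (hB : Commute M B)
    (hAB : ¬ Commute A B) : M = M 0 0 • (1 : Matrix (Fin 2) (Fin 2) R) := by
  have entries : ∀ P Q : Matrix (Fin 2) (Fin 2) R, Commute P Q ↔
      P 0 1 * Q 1 0 = P 1 0 * Q 0 1 ∧
      (P 0 0 - P 1 1) * Q 0 1 = P 0 1 * (Q 0 0 - Q 1 1) ∧
      (P 0 0 - P 1 1) * Q 1 0 = P 1 0 * (Q 0 0 - Q 1 1) := by
    intro P Q
    simp only [Commute, SemiconjBy, ← Matrix.ext_iff, Fin.forall_fin_two, Matrix.mul_apply,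
      Fin.sum_univ_two]
    grind
  rw [entries] at hA hB hAB
  have h01 : M 0 1 = 0 := by
    by_contra h
    refine hAB ⟨mul_left_cancel₀ h ?_, mul_left_cancel₀ h ?_, mul_left_cancel₀ h ?_⟩ <;> grind
  have h10 : M 1 0 = 0 := by
    by_contra h
    refine hAB ⟨mul_left_cancel₀ h ?_, mul_left_cancel₀ h ?_, mul_left_cancel₀ h ?_⟩ <;> grind
  have h11 : M 0 0 - M 1 1 = 0 := by
    by_contra h
    refine hAB ⟨mul_left_cancel₀ h ?_, mul_left_cancel₀ h ?_, mul_left_cancel₀ h ?_⟩ <;> grind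
  ext i j
  fin_cases i <;> fin_cases j <;> simp [h01, h10, ← sub_eq_zero.mp h11]

/-- If `X`, `Y` are trace-free elements of `SU(2)` which do not commute (an irreducible pair),
then the joint centralizer `{g ∈ SU(2) : gX = Xg, gY = Yg}` is exactly `{1, -1}`: the
conjugation action of `SU(2)` is locally free precisely at irreducible tuples. -/
theorem joint_centralizer_of_irreducible (X Y : Matrix.specialUnitaryGroup (Fin 2) ℂ)
    (hX : Matrix.trace (X : Matrix (Fin 2) (Fin 2) ℂ) = 0)
    (hY : Matrix.trace (Y : Matrix (Fin 2) (Fin 2) ℂ) = 0)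
    (hXY : X * Y ≠ Y * X) :
    ∀ g : Matrix.specialUnitaryGroup (Fin 2) ℂ,
      (g * X = X * g ∧ g * Y = Y * g) ↔
        ((g : Matrix (Fin 2) (Fin 2) ℂ) = 1 ∨ (g : Matrix (Fin 2) (Fin 2) ℂ) = -1) := by
  intro g
  constructor
  · rintro ⟨hgX, hgY⟩
    have hg := Matrix.eq_smul_one_of_commute_of_not_commute
      (congrArg Subtype.val hgX) (congrArg Subtype.val hgY) (fun h => hXY (Subtype.ext h))
    have hdet := (Matrix.mem_specialUnitaryGroup_iff.mp g.2).2
    rw [hg, Matrix.det_smul, Matrix.det_one, mul_one, Fintype.card_fin, sq_eq_one_iff] at hdet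
    rcases hdet with h | h
    · left
      rw [hg, h, one_smul]
    · right
      rw [hg, h, neg_one_smul]
  · rintro (h | h) <;> constructor <;> apply Subtype.ext <;> simp [h]
end

section
/- There exists a continuous map h : {X ∈ SU(2) : X ≠ -1} × [0,1] → SU(2) such that for every X ≠ -1 and all s, t ∈ [0,1]: h(X, 0) = 1, h(X, 1) = X, and h(X, t) commutes with X. (This is the 'Casson deformation' X ↦ X^t, a continuous choice of path from the identity to X inside the centralizer of X, defined on SU(2) with -1 removed.) -/
open Matrix ComplexConjugate

namespace Matrix

/-- The second row of a matrix in `SU(2)` is determined by its first row. -/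
theorem specialUnitaryGroup_fin_two_apply {X : Matrix (Fin 2) (Fin 2) ℂ}
    (hX : X ∈ specialUnitaryGroup (Fin 2) ℂ) :
    X 1 1 = conj (X 0 0) ∧ X 1 0 = -conj (X 0 1) ∧
      Complex.normSq (X 0 0) + Complex.normSq (X 0 1) = 1 := by
  obtain ⟨hU, hdet⟩ := mem_specialUnitaryGroup_iff.1 hX
  have hadj : star X = X.adjugate := by
    calc star X = star X * (X * X.adjugate) := by rw [mul_adjugate, hdet, one_smul, mul_one]
      _ = X.adjugate := by rw [← mul_assoc, mem_unitaryGroup_iff'.1 hU, one_mul]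
  have h00 : conj (X 0 0) = X 1 1 := by
    simpa [adjugate_fin_two, star_apply] using congrFun (congrFun hadj 0) 0
  have h10 : conj (X 0 1) = -X 1 0 := by
    simpa [adjugate_fin_two, star_apply] using congrFun (congrFun hadj 1) 0
  refine ⟨h00.symm, by rw [h10, neg_neg], ?_⟩
  rw [det_fin_two, ← h00, ← neg_eq_iff_eq_neg.2 h10, mul_neg, sub_neg_eq_add,
    Complex.mul_conj, Complex.mul_conj] at hdet
  exact_mod_cast hdet

/-- A matrix of quaternionic shape whose first row is a unit vector lies in `SU(2)`. -/
theorem mem_specialUnitaryGroup_fin_two {X : Matrix (Fin 2) (Fin 2) ℂ}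
    (h11 : X 1 1 = conj (X 0 0)) (h10 : X 1 0 = -conj (X 0 1))
    (hn : Complex.normSq (X 0 0) + Complex.normSq (X 0 1) = 1) :
    X ∈ specialUnitaryGroup (Fin 2) ℂ := by
  have hnorm : X 0 0 * conj (X 0 0) + X 0 1 * conj (X 0 1) = 1 := by
    rw [Complex.mul_conj, Complex.mul_conj]
    exact_mod_cast hn
  refine mem_specialUnitaryGroup_iff.2 ⟨mem_unitaryGroup_iff.2 ?_, ?_⟩
  · ext i j
    fin_cases i <;> fin_cases j <;>
      simp [mul_apply, Fin.sum_univ_two, star_apply, h11, h10] <;>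
      first | linear_combination hnorm | ring
  · rw [det_fin_two, h11, h10]
    linear_combination hnorm

/-- The squared norm of the first row of the point `(1 - t) + t X` on the segment from `1` to
`X`. -/
noncomputable def segmentNormSq (X : Matrix (Fin 2) (Fin 2) ℂ) (t : ℝ) : ℝ :=
  Complex.normSq ((1 - t) + t * X 0 0) + Complex.normSq (t * X 0 1)

/-- The segment from `1` to `X ∈ SU(2)` avoids the zero matrix unless `X = -1`. -/
theorem segmentNormSq_pos {X : Matrix (Fin 2) (Fin 2) ℂ}
    (hX : X ∈ specialUnitaryGroup (Fin 2) ℂ) (hX' : X ≠ -1) (t : ℝ) :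
    0 < segmentNormSq X t := by
  obtain ⟨h11, h10, hn⟩ := specialUnitaryGroup_fin_two_apply hX
  have hre : -1 < (X 0 0).re := by
    by_contra! hle
    simp only [Complex.normSq_apply] at hn
    have hre : (X 0 0).re = -1 := by
      nlinarith [mul_self_nonneg (X 0 0).im, mul_self_nonneg (X 0 1).re,
        mul_self_nonneg (X 0 1).im]
    rw [hre] at hn
    have him : (X 0 0).im = 0 := by
      nlinarith [mul_self_nonneg (X 0 1).re, mul_self_nonneg (X 0 1).im]
    have h01re : (X 0 1).re = 0 := by
      nlinarith [mul_self_nonneg (X 0 0).im, mul_self_nonneg (X 0 1).im]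
    have h01im : (X 0 1).im = 0 := by
      nlinarith [mul_self_nonneg (X 0 0).im, mul_self_nonneg (X 0 1).re]
    have h00 : X 0 0 = -1 := Complex.ext (by simpa using hre) (by simpa using him)
    have h01 : X 0 1 = 0 := Complex.ext h01re h01im
    apply hX'
    ext i j
    fin_cases i <;> fin_cases j <;> simp [h00, h01, h10, h11]
  have hle : (X 0 0).re ≤ 1 := by
    simp only [Complex.normSq_apply] at hn
    nlinarith [mul_self_nonneg (X 0 0).im, mul_self_nonneg (X 0 1).re,
      mul_self_nonneg (X 0 1).im]
  have hval : segmentNormSq X t =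
      (2 * t - 1) ^ 2 * (1 - (X 0 0).re) / 2 + (1 + (X 0 0).re) / 2 := by
    simp only [Complex.normSq_apply] at hn
    simp only [segmentNormSq, Complex.normSq_apply, Complex.add_re, Complex.add_im,
      Complex.sub_re, Complex.sub_im, Complex.one_re, Complex.one_im, Complex.ofReal_re,
      Complex.ofReal_im, Complex.re_ofReal_mul, Complex.im_ofReal_mul]
    linear_combination t ^ 2 * hn
  rw [hval]
  have : 0 ≤ (2 * t - 1) ^ 2 * (1 - (X 0 0).re) :=
    mul_nonneg (sq_nonneg _) (by linarith)
  linarith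

/-- The radial projection to `SU(2)` of the segment from `1` to `X`. -/
noncomputable def normalizedSegment (X : Matrix (Fin 2) (Fin 2) ℂ) (t : ℝ) :
    Matrix (Fin 2) (Fin 2) ℂ :=
  (((√(segmentNormSq X t))⁻¹ : ℝ) : ℂ) • ((1 - t : ℂ) • 1 + (t : ℂ) • X)

theorem normalizedSegment_mem {X : Matrix (Fin 2) (Fin 2) ℂ}
    (hX : X ∈ specialUnitaryGroup (Fin 2) ℂ) (hX' : X ≠ -1) (t : ℝ) :
    normalizedSegment X t ∈ specialUnitaryGroup (Fin 2) ℂ := by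
  obtain ⟨h11, h10, -⟩ := specialUnitaryGroup_fin_two_apply hX
  have hpos := segmentNormSq_pos hX hX' t
  apply mem_specialUnitaryGroup_fin_two
  · simp [normalizedSegment, h11]
  · simp [normalizedSegment, h10]
  · have h00 : normalizedSegment X t 0 0 =
        (((√(segmentNormSq X t))⁻¹ : ℝ) : ℂ) * ((1 - t) + t * X 0 0) := by
      simp [normalizedSegment]
    have h01 : normalizedSegment X t 0 1 =
        (((√(segmentNormSq X t))⁻¹ : ℝ) : ℂ) * (t * X 0 1) := by
      simp [normalizedSegment]
    rw [h00, h01, Complex.normSq_mul, Complex.normSq_mul _ (_ * _), ← mul_add,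
      ← segmentNormSq, Complex.normSq_ofReal, ← mul_inv, Real.mul_self_sqrt hpos.le,
      inv_mul_cancel₀ hpos.ne']

theorem normalizedSegment_zero (X : Matrix (Fin 2) (Fin 2) ℂ) : normalizedSegment X 0 = 1 := by
  simp [normalizedSegment, segmentNormSq]

theorem normalizedSegment_one {X : Matrix (Fin 2) (Fin 2) ℂ}
    (hX : X ∈ specialUnitaryGroup (Fin 2) ℂ) : normalizedSegment X 1 = X := by
  simp [normalizedSegment, segmentNormSq, (specialUnitaryGroup_fin_two_apply hX).2.2]

theorem commute_normalizedSegment (X : Matrix (Fin 2) (Fin 2) ℂ) (t : ℝ) :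
    Commute (normalizedSegment X t) X :=
  (((Commute.one_left X).smul_left _).add_left ((Commute.refl X).smul_left _)).smul_left _

theorem continuous_segmentNormSq :
    Continuous fun p : Matrix (Fin 2) (Fin 2) ℂ × ℝ => segmentNormSq p.1 p.2 := by
  unfold segmentNormSq
  have hentry : ∀ i j, Continuous fun p : Matrix (Fin 2) (Fin 2) ℂ × ℝ => p.1 i j :=
    fun i j => continuous_fst.matrix_elem i j
  have h00 := hentry 0 0
  have h01 := hentry 0 1
  have hnormSq := Complex.continuous_normSq
  fun_prop

end Matrix

/-- The Casson deformation `X ↦ Xᵗ`: there is a continuous map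
`h : {X ∈ SU(2) : X ≠ -1} × [0,1] → SU(2)` with `h(X,0) = 1`, `h(X,1) = X`, and `h(X,t)`
commuting with `X` for all `t`. -/
theorem exists_casson_deformation :
    ∃ h : {X : Matrix.specialUnitaryGroup (Fin 2) ℂ //
            (X : Matrix (Fin 2) (Fin 2) ℂ) ≠ -1} × unitInterval →
          Matrix.specialUnitaryGroup (Fin 2) ℂ,
      Continuous h ∧
      ∀ (X : {X : Matrix.specialUnitaryGroup (Fin 2) ℂ //
              (X : Matrix (Fin 2) (Fin 2) ℂ) ≠ -1}) (t : unitInterval),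
        h (X, 0) = 1 ∧ h (X, 1) = (X : Matrix.specialUnitaryGroup (Fin 2) ℂ) ∧
        h (X, t) * (X : Matrix.specialUnitaryGroup (Fin 2) ℂ) =
          (X : Matrix.specialUnitaryGroup (Fin 2) ℂ) * h (X, t) := by
  refine ⟨fun p => ⟨normalizedSegment p.1.1 p.2, normalizedSegment_mem p.1.1.2 p.1.2 p.2⟩,
    Continuous.subtype_mk ?_ _, fun X t => ⟨Subtype.ext ?_, Subtype.ext ?_, Subtype.ext ?_⟩⟩
  · have hnorm : Continuous fun p : {X : Matrix.specialUnitaryGroup (Fin 2) ℂ //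
        (X : Matrix (Fin 2) (Fin 2) ℂ) ≠ -1} × unitInterval =>
          (√(segmentNormSq (p.1.1 : Matrix (Fin 2) (Fin 2) ℂ) p.2))⁻¹ := by
      refine Continuous.inv₀ (Real.continuous_sqrt.comp (continuous_segmentNormSq.comp
        (f := fun p : {X : Matrix.specialUnitaryGroup (Fin 2) ℂ //
          (X : Matrix (Fin 2) (Fin 2) ℂ) ≠ -1} × unitInterval =>
            ((p.1.1 : Matrix (Fin 2) (Fin 2) ℂ), (p.2 : ℝ))) (by fun_prop))) fun p => ?_
      exact (Real.sqrt_pos.2 (segmentNormSq_pos p.1.1.2 p.1.2 p.2)).ne'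
    unfold normalizedSegment
    fun_prop
  · exact normalizedSegment_zero _
  · exact normalizedSegment_one X.1.2
  · exact commute_normalizedSegment _ _
end

section
/- Let θ₁ ∈ (0, π) and let Y₁, Y₂ ∈ SU(2) be trace-free elements with Y₁ * Y₂ = X(θ₁) * D. Then there exists θ₂ ∈ (-π, π] such that Y₁ = X(θ₂) (and consequently Y₂ = X(θ₂)⁻¹ * X(θ₁) * D). Hence the trace-free solutions (Y₁, Y₂) of Y₁Y₂ = X(θ₁)D are parametrized by a circle of angles θ₂. -/
/-- The matrix `X(θ) = ![![i cos θ, sin θ], ![-sin θ, -i cos θ]]`. -/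
noncomputable def Xθ (θ : ℝ) : Matrix (Fin 2) (Fin 2) ℂ :=
  !![Complex.I * (Real.cos θ : ℂ), (Real.sin θ : ℂ);
     -(Real.sin θ : ℂ), -(Complex.I * (Real.cos θ : ℂ))]

/-- The diagonal matrix `D = ![![i, 0], ![0, -i]]`. -/
def Dmat : Matrix (Fin 2) (Fin 2) ℂ := !![Complex.I, 0; 0, -Complex.I]

/-- The conjugate transpose of an element of `SU(n)` is its adjugate. -/
lemma Matrix.star_eq_adjugate_of_mem_specialUnitaryGroup {n : Type*} [Fintype n] [DecidableEq n]
    {A : Matrix n n ℂ} (hA : A ∈ Matrix.specialUnitaryGroup n ℂ) : star A = A.adjugate := by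
  obtain ⟨hU, hdet⟩ := Matrix.mem_specialUnitaryGroup_iff.mp hA
  calc star A = star A * (A * A.adjugate) := by rw [Matrix.mul_adjugate, hdet, one_smul, mul_one]
    _ = A.adjugate := by rw [← mul_assoc, Matrix.mem_unitaryGroup_iff'.mp hU, one_mul]

/-- A trace-free `2 × 2` matrix of determinant one squares to `-1`. -/
lemma Matrix.mul_self_eq_neg_one_of_trace_eq_zero {R : Type*} [CommRing R]
    {A : Matrix (Fin 2) (Fin 2) R} (htr : A.trace = 0) (hdet : A.det = 1) : A * A = -1 := by
  rw [Matrix.trace_fin_two] at htr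
  have hadj : A.adjugate = -A := by
    rw [Matrix.adjugate_fin_two]
    ext i j
    fin_cases i <;> fin_cases j <;> simp <;> linear_combination htr
  have h := Matrix.mul_adjugate A
  rwa [hadj, hdet, one_smul, mul_neg, neg_eq_iff_eq_neg] at h

/-- A point of the unit circle has an angle in `(-π, π]`. -/
lemma exists_angle_of_sq_add_sq_eq_one {x y : ℝ} (h : x ^ 2 + y ^ 2 = 1) :
    ∃ θ ∈ Set.Ioc (-Real.pi) Real.pi, Real.cos θ = x ∧ Real.sin θ = y := by
  have hnorm : ‖(⟨x, y⟩ : ℂ)‖ = 1 := by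
    rw [Complex.norm_eq_sqrt_sq_add_sq, h, Real.sqrt_one]
  refine ⟨Complex.arg ⟨x, y⟩, Complex.arg_mem_Ioc _, ?_, ?_⟩
  · rw [Complex.cos_arg (norm_ne_zero_iff.mp (hnorm ▸ one_ne_zero)), hnorm, div_one]
  · rw [Complex.sin_arg, hnorm, div_one]

lemma det_Xθ (θ : ℝ) : (Xθ θ).det = 1 := by
  have h : (Real.sin θ : ℂ) ^ 2 + (Real.cos θ : ℂ) ^ 2 = 1 := by
    exact_mod_cast Real.sin_sq_add_cos_sq θ
  rw [Xθ, Matrix.det_fin_two_of]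
  linear_combination h - (Real.cos θ : ℂ) ^ 2 * Complex.I_sq

lemma trace_mul_Xθ_mul_Dmat (A : Matrix (Fin 2) (Fin 2) ℂ) (θ : ℝ) :
    (A * (Xθ θ * Dmat)).trace =
      -(Real.cos θ * A.trace) - Complex.I * Real.sin θ * (A 0 1 + A 1 0) := by
  simp only [Xθ, Dmat, Matrix.trace_fin_two, Matrix.mul_apply, Fin.sum_univ_two, Matrix.of_apply,
    Matrix.cons_val_zero, Matrix.cons_val_one, Matrix.cons_val']
  linear_combination (A 0 0 + A 1 1) * Real.cos θ * Complex.I_sq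

/-- A trace-free element of `SU(2)` whose off-diagonal entries sum to zero is some `X(θ)`. -/
lemma exists_eq_Xθ {A : Matrix (Fin 2) (Fin 2) ℂ} (hA : A ∈ Matrix.specialUnitaryGroup (Fin 2) ℂ)
    (htr : A.trace = 0) (hoff : A 0 1 + A 1 0 = 0) :
    ∃ θ ∈ Set.Ioc (-Real.pi) Real.pi, A = Xθ θ := by
  have hstar := Matrix.star_eq_adjugate_of_mem_specialUnitaryGroup hA
  have hdet := (Matrix.mem_specialUnitaryGroup_iff.mp hA).2
  rw [Matrix.adjugate_fin_two] at hstar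
  rw [Matrix.trace_fin_two] at htr
  rw [Matrix.det_fin_two] at hdet
  have h11 : A 1 1 = -A 0 0 := by linear_combination htr
  have h10 : A 1 0 = -A 0 1 := by linear_combination hoff
  have hre : (A 0 0).re = 0 := by
    have h := congrArg Complex.re (congrFun (congrFun hstar 0) 0)
    simp [Matrix.star_apply, h11] at h
    linarith
  have him : (A 0 1).im = 0 := by
    have h := congrArg Complex.im (congrFun (congrFun hstar 1) 0)
    simp [Matrix.star_apply, h10] at h
    linarith
  have h00 : A 0 0 = Complex.I * ((A 0 0).im : ℂ) := by
    apply Complex.ext <;> simp [hre]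
  have h01 : A 0 1 = ((A 0 1).re : ℂ) := by
    apply Complex.ext <;> simp [him]
  have hcircle : (A 0 0).im ^ 2 + (A 0 1).re ^ 2 = 1 := by
    have h := congrArg Complex.re hdet
    simp [h11, h10, hre, him] at h
    linarith
  obtain ⟨θ, hθ, hcos, hsin⟩ := exists_angle_of_sq_add_sq_eq_one hcircle
  refine ⟨θ, hθ, ?_⟩
  rw [Matrix.eta_fin_two A, Xθ, hcos, hsin, h11, h10, ← h00, ← h01]

/-- For `θ₁ ∈ (0, π)`, the trace-free solutions `(Y₁, Y₂)` in `SU(2)` of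
`Y₁ Y₂ = X(θ₁) D` are parametrized by a circle: `Y₁ = X(θ₂)` for some angle
`θ₂ ∈ (-π, π]`, and consequently `Y₂ = X(θ₂)⁻¹ X(θ₁) D`. -/
theorem traceFree_solutions_parametrized_by_circle (θ₁ : ℝ)
    (hθ₁ : θ₁ ∈ Set.Ioo (0 : ℝ) Real.pi)
    (Y₁ Y₂ : Matrix.specialUnitaryGroup (Fin 2) ℂ)
    (h₁ : Matrix.trace (Y₁ : Matrix (Fin 2) (Fin 2) ℂ) = 0)
    (h₂ : Matrix.trace (Y₂ : Matrix (Fin 2) (Fin 2) ℂ) = 0)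
    (hprod : (Y₁ : Matrix (Fin 2) (Fin 2) ℂ) * (Y₂ : Matrix (Fin 2) (Fin 2) ℂ) =
      Xθ θ₁ * Dmat) :
    ∃ θ₂ ∈ Set.Ioc (-Real.pi) Real.pi,
      (Y₁ : Matrix (Fin 2) (Fin 2) ℂ) = Xθ θ₂ ∧
      (Y₂ : Matrix (Fin 2) (Fin 2) ℂ) = (Xθ θ₂)⁻¹ * Xθ θ₁ * Dmat := by
  have hdet := (Matrix.mem_specialUnitaryGroup_iff.mp Y₁.2).2
  have hoff : Y₁.1 0 1 + Y₁.1 1 0 = 0 := by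
    have htr := trace_mul_Xθ_mul_Dmat Y₁.1 θ₁
    rw [← hprod, ← mul_assoc, Matrix.mul_self_eq_neg_one_of_trace_eq_zero h₁ hdet, neg_one_mul,
      Matrix.trace_neg, h₁, h₂, mul_zero, neg_zero, zero_sub, zero_eq_neg] at htr
    have hsin : (Real.sin θ₁ : ℂ) ≠ 0 :=
      Complex.ofReal_ne_zero.mpr (Real.sin_pos_of_mem_Ioo hθ₁).ne'
    exact (mul_eq_zero.mp htr).resolve_left (mul_ne_zero Complex.I_ne_zero hsin)
  obtain ⟨θ₂, hθ₂, hY₁⟩ := exists_eq_Xθ Y₁.2 h₁ hoff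
  refine ⟨θ₂, hθ₂, hY₁, ?_⟩
  rw [mul_assoc, ← hprod, hY₁, Matrix.nonsing_inv_mul_cancel_left]
  rw [det_Xθ]
  exact isUnit_one
end

section
/- Let θ ∈ (0, π) and set C = X(θ) * D ∈ SU(2). Then the two equations C * X(θ) * C⁻¹ = D and C² * X(θ)⁻¹ * C⁻¹ = X(θ) hold simultaneously if and only if θ = 2π/3. (These equations say that the pair (X(θ), D) is fixed by the action of the braid σ₁³ whose closure is the right-handed trefoil knot, since σ₁³ sends (X₁, X₂) to ((X₁X₂)² X₁⁻¹ (X₁X₂)⁻¹, (X₁X₂) X₁ (X₁X₂)⁻¹); hence the trefoil braid has exactly one fixed irreducible trace-free SU(2) representation class.) -/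
theorem Xθ_mul_self (θ : ℝ) : Xθ θ * Xθ θ = -1 := by
  have h : (Real.sin θ : ℂ) ^ 2 + (Real.cos θ : ℂ) ^ 2 = 1 := by
    exact_mod_cast Real.sin_sq_add_cos_sq θ
  ext i j
  fin_cases i <;> fin_cases j <;> simp [Xθ, -Complex.ofReal_sin, -Complex.ofReal_cos] <;>
    grind [Complex.I_mul_I]

theorem Dmat_mul_self : Dmat * Dmat = -1 := by
  ext i j
  fin_cases i <;> fin_cases j <;> simp [Dmat]

theorem Xθ_mul_Dmat_add_Dmat_mul_Xθ (θ : ℝ) :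
    Xθ θ * Dmat + Dmat * Xθ θ = (-2 * (Real.cos θ : ℂ)) • 1 := by
  ext i j
  fin_cases i <;> fin_cases j <;>
    simp [Xθ, Dmat, -Complex.ofReal_sin, -Complex.ofReal_cos] <;> grind [Complex.I_mul_I]

theorem Xθ_inv (θ : ℝ) : (Xθ θ)⁻¹ = -Xθ θ :=
  Matrix.inv_eq_right_inv (by rw [mul_neg, Xθ_mul_self, neg_neg])

theorem Xθ_mul_Dmat_mul_Dmat_mul_Xθ (θ : ℝ) : Xθ θ * Dmat * (Dmat * Xθ θ) = 1 := by
  rw [mul_assoc, ← mul_assoc Dmat, Dmat_mul_self, neg_one_mul, mul_neg, Xθ_mul_self, neg_neg]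

theorem Xθ_mul_Dmat_inv (θ : ℝ) : (Xθ θ * Dmat)⁻¹ = Dmat * Xθ θ :=
  Matrix.inv_eq_right_inv (Xθ_mul_Dmat_mul_Dmat_mul_Xθ θ)

/-- The braid relation `X D X = D X D` holds when `cos θ = -1/2`. -/
theorem Xθ_braid_of_cos_eq {θ : ℝ} (h : Real.cos θ = -1 / 2) :
    Xθ θ * Dmat * Xθ θ = Dmat * Xθ θ * Dmat := by
  have hsum : Xθ θ * Dmat + Dmat * Xθ θ = 1 := by
    rw [Xθ_mul_Dmat_add_Dmat_mul_Xθ, h]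
    norm_num
  have hXD : Xθ θ * Dmat = 1 - Dmat * Xθ θ := eq_sub_of_add_eq hsum
  rw [mul_assoc Dmat, hXD, sub_mul, mul_sub, mul_assoc, Xθ_mul_self, ← mul_assoc Dmat,
    Dmat_mul_self]
  simp [add_comm]

theorem cos_eq_of_Xθ_conj_eq_Dmat {θ : ℝ} (hs : Real.sin θ ≠ 0)
    (h : Xθ θ * Dmat * Xθ θ * (Xθ θ * Dmat)⁻¹ = Dmat) : Real.cos θ = -1 / 2 := by
  have hinv : (Xθ θ * Dmat)⁻¹ * (Xθ θ * Dmat) = 1 := by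
    rw [Xθ_mul_Dmat_inv]
    exact mul_eq_one_comm.mp (Xθ_mul_Dmat_mul_Dmat_mul_Xθ θ)
  have hcomm : Xθ θ * Dmat * Xθ θ = Dmat * (Xθ θ * Dmat) := by
    calc Xθ θ * Dmat * Xθ θ
        = Xθ θ * Dmat * Xθ θ * ((Xθ θ * Dmat)⁻¹ * (Xθ θ * Dmat)) := by rw [hinv, mul_one]
      _ = Dmat * (Xθ θ * Dmat) := by rw [← mul_assoc _ (Xθ θ * Dmat)⁻¹, h]
  have h01 := congrFun (congrFun hcomm 0) 1
  simp [Xθ, Dmat, -Complex.ofReal_sin, -Complex.ofReal_cos] at h01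
  have hmul : (Real.sin θ : ℂ) * (2 * (Real.cos θ : ℂ) + 1) = 0 := by
    grind [Complex.I_mul_I]
  have hmul' : Real.sin θ * (2 * Real.cos θ + 1) = 0 := by exact_mod_cast hmul
  have := (mul_eq_zero.mp hmul').resolve_left hs
  linarith

/-- Fixed-point equations for the trefoil braid `σ₁³`: for `θ ∈ (0, π)` and
`C = X(θ) D`, the equations `C X(θ) C⁻¹ = D` and `C² X(θ)⁻¹ C⁻¹ = X(θ)` hold
simultaneously iff `θ = 2π/3`; hence the trefoil braid has exactly one fixed
irreducible trace-free `SU(2)` representation class. -/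
theorem trefoil_fixed_point_iff (θ : ℝ) (hθ : θ ∈ Set.Ioo (0 : ℝ) Real.pi) :
    (Xθ θ * Dmat) * Xθ θ * (Xθ θ * Dmat)⁻¹ = Dmat ∧
      (Xθ θ * Dmat) ^ 2 * (Xθ θ)⁻¹ * (Xθ θ * Dmat)⁻¹ = Xθ θ ↔
    θ = 2 * Real.pi / 3 := by
  have hcos : Real.cos (2 * Real.pi / 3) = -1 / 2 := by
    rw [show 2 * Real.pi / 3 = Real.pi - Real.pi / 3 by ring, Real.cos_pi_sub,
      Real.cos_pi_div_three]
    norm_num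
  constructor
  · rintro ⟨h, -⟩
    have hπ := Real.pi_pos
    refine Real.injOn_cos ⟨hθ.1.le, hθ.2.le⟩ ⟨by positivity, by linarith⟩ ?_
    rw [cos_eq_of_Xθ_conj_eq_Dmat (Real.sin_pos_of_mem_Ioo hθ).ne' h, hcos]
  · rintro rfl
    have hbraid := Xθ_braid_of_cos_eq hcos
    rw [Xθ_mul_Dmat_inv, Xθ_inv]
    generalize 2 * Real.pi / 3 = θ at *
    have hX := Xθ_mul_self θ
    have hD := Dmat_mul_self
    have hconj : Xθ θ * Dmat * Xθ θ * (Dmat * Xθ θ) = Dmat := by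
      rw [hbraid, mul_assoc (Dmat * Xθ θ), ← mul_assoc Dmat Dmat, hD, neg_one_mul, mul_neg,
        mul_assoc, hX, mul_neg, mul_one, neg_neg]
    refine ⟨hconj, ?_⟩
    calc (Xθ θ * Dmat) ^ 2 * -Xθ θ * (Dmat * Xθ θ)
        = -(Xθ θ * Dmat * (Xθ θ * Dmat * Xθ θ * (Dmat * Xθ θ))) := by noncomm_ring
      _ = Xθ θ := by rw [hconj, mul_assoc, hD, mul_neg, mul_one, neg_neg]
end
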